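/- Let k be a field of characteristic p > 0 and K = k(x,y). Let m_x, m_y ∈ ℤ and consider the derivation ∂ = y^{m_y}·∂_x + x^{m_x}·∂_y of K, where negative exponents denote inverses in the field K. Set n_x = m_x + 1 and n_y = m_y + 1. Then ∂ is p-closed (there exists a ∈ K with ∂^p = a·∂) if and only if either (p ∤ n_x and p ∤ n_y) or (n_x = 0 and n_y = 0). -/

import Mathlib

open MvPolynomial

noncomputable section

/-- The rational function field `k(x,y)`, realized as the fraction field of `k[x,y]`. -/
abbrev RatFld2 (k : Type) [Field k] : Type := FractionRing (MvPolynomial (Fin 2) k)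

/-- The image of the indeterminate `x` in `k(x,y)`. -/
abbrev xK (k : Type) [Field k] : RatFld2 k :=
  algebraMap (MvPolynomial (Fin 2) k) (RatFld2 k) (X 0)

/-- The image of the indeterminate `y` in `k(x,y)`. -/
abbrev yK (k : Type) [Field k] : RatFld2 k :=
  algebraMap (MvPolynomial (Fin 2) k) (RatFld2 k) (X 1)

section HochschildFormula

variable {R A : Type*} [CommRing R] [CommRing A] [Algebra R A]

/-- The coefficients, in powers of `T`, of `(D + T u)ⁿ 1`. -/
def bellCoeff (D : Derivation R A A) (u : A) : ℕ → ℕ → A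
  | 0, 0 => 1
  | 0, _ + 1 => 0
  | n + 1, 0 => D (bellCoeff D u n 0)
  | n + 1, k + 1 => D (bellCoeff D u n (k + 1)) + u * bellCoeff D u n k

variable (D : Derivation R A A) (u : A)

lemma bellCoeff_succ_zero (n : ℕ) : bellCoeff D u (n + 1) 0 = 0 := by
  induction n with
  | zero => simp [bellCoeff]
  | succ n ih => rw [bellCoeff, ih, map_zero]

lemma bellCoeff_succ_one (n : ℕ) : bellCoeff D u (n + 1) 1 = D^[n] u := by
  induction n with
  | zero => simp [bellCoeff]
  | succ n ih =>
    rw [bellCoeff, ih, bellCoeff_succ_zero, mul_zero, add_zero, Function.iterate_succ_apply']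

lemma bellCoeff_eq_zero_of_lt {n k : ℕ} (h : n < k) : bellCoeff D u n k = 0 := by
  induction n generalizing k with
  | zero => obtain ⟨k, rfl⟩ := Nat.exists_eq_succ_of_ne_zero h.ne'; rfl
  | succ n ih =>
    obtain ⟨k, rfl⟩ := Nat.exists_eq_succ_of_ne_zero (Nat.ne_zero_of_lt h)
    rw [bellCoeff, ih (by omega), ih (by omega)]
    simp

lemma bellCoeff_self (n : ℕ) : bellCoeff D u n n = u ^ n := by
  induction n with
  | zero => simp [bellCoeff]
  | succ n ih => rw [bellCoeff, ih, bellCoeff_eq_zero_of_lt D u n.lt_succ_self, map_zero]; ring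

lemma iterate_eq_mul_sum_bellCoeff {x : A} (hx : D x = x * u) (n : ℕ) :
    D^[n] x = x * ∑ k ∈ Finset.range (n + 1), bellCoeff D u n k := by
  induction n with
  | zero => simp [bellCoeff]
  | succ n ih =>
    have h₁ : ∑ k ∈ Finset.range (n + 1), D (bellCoeff D u n (k + 1)) + D (bellCoeff D u n 0) =
        D (∑ k ∈ Finset.range (n + 1), bellCoeff D u n k) := by
      rw [← Finset.sum_range_succ' (fun k => D (bellCoeff D u n k)), Finset.sum_range_succ,
        bellCoeff_eq_zero_of_lt D u n.lt_succ_self, map_zero, add_zero, map_sum]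
    rw [Function.iterate_succ_apply', ih, Finset.sum_range_succ' _ (n + 1)]
    simp only [bellCoeff, Finset.sum_add_distrib, ← Finset.mul_sum, D.leibniz, smul_eq_mul, hx]
    linear_combination -x * h₁

/-- The recursion obtained by differentiating `(D + T u)ⁿ 1` with respect to `T`. -/
lemma succ_mul_bellCoeff (n k : ℕ) :
    ((k : A) + 1) * bellCoeff D u n (k + 1) = ∑ ij ∈ Finset.HasAntidiagonal.antidiagonal n,
      (n.choose ij.1 : A) * ((if ij.1 = 0 then 0 else D^[ij.1 - 1] u) * bellCoeff D u ij.2 k) := by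
  induction n generalizing k with
  | zero => simp [bellCoeff]
  | succ n ih =>
    set w : ℕ → A := fun i => if i = 0 then 0 else D^[i - 1] u with hw
    have hw_succ (i : ℕ) : w (i + 1) = D (w i) + if i = 0 then u else 0 := by
      cases i with
      | zero => simp [hw]
      | succ i => simp [hw, Function.iterate_succ_apply']
    have hD : D (∑ ij ∈ Finset.HasAntidiagonal.antidiagonal n,
        (n.choose ij.1 : A) * (w ij.1 * bellCoeff D u ij.2 k)) =
        ∑ ij ∈ Finset.HasAntidiagonal.antidiagonal n, ((n.choose ij.1 : A) * (w ij.1 * D (bellCoeff D u ij.2 k)) +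
          (n.choose ij.1 : A) * (D (w ij.1) * bellCoeff D u ij.2 k)) := by
      rw [map_sum]
      refine Finset.sum_congr rfl fun ij _ => ?_
      simp only [D.leibniz, D.map_natCast, smul_eq_mul]
      ring
    have hdelta : ∑ ij ∈ Finset.HasAntidiagonal.antidiagonal n, (n.choose ij.1 : A) *
        ((if ij.1 = 0 then u else 0) * bellCoeff D u ij.2 k) = u * bellCoeff D u n k := by
      rw [Finset.sum_eq_single (0, n)]
      · simp
      · rintro ⟨i, j⟩ hij hne
        have : i ≠ 0 := by
          rintro rfl
          simp at hij
          exact hne (by rw [hij])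
        simp [this]
      · simp
    have hsplit := Finset.sum_antidiagonal_choose_succ_mul
      (fun i j => w i * bellCoeff D u j k) n
    change _ = ∑ ij ∈ Finset.HasAntidiagonal.antidiagonal (n + 1), ((n + 1).choose ij.1 : A) *
      (w ij.1 * bellCoeff D u ij.2 k)
    rw [hsplit]
    have hsymm : ∑ ij ∈ Finset.HasAntidiagonal.antidiagonal n,
        (n.choose ij.2 : A) * (w (ij.1 + 1) * bellCoeff D u ij.2 k) =
        ∑ ij ∈ Finset.HasAntidiagonal.antidiagonal n, ((n.choose ij.1 : A) * (D (w ij.1) * bellCoeff D u ij.2 k) +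
          (n.choose ij.1 : A) * ((if ij.1 = 0 then u else 0) * bellCoeff D u ij.2 k)) := by
      refine Finset.sum_congr rfl fun ij hij => ?_
      rw [Nat.choose_symm_of_eq_add (Finset.HasAntidiagonal.mem_antidiagonal.1 hij).symm, hw_succ]
      ring
    rw [hsymm, Finset.sum_add_distrib, hdelta]
    rw [← ih k, Finset.sum_add_distrib, D.leibniz] at hD
    simp only [map_add, D.map_natCast, D.map_one_eq_zero, smul_eq_mul] at hD
    cases k with
    | zero =>
      simp only [bellCoeff, Nat.cast_zero] at hD ⊢
      linear_combination hD
    | succ k =>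
      have ihk := ih k
      change _ = ∑ ij ∈ Finset.HasAntidiagonal.antidiagonal n,
        (n.choose ij.1 : A) * (w ij.1 * bellCoeff D u ij.2 k) at ihk
      have hmid : ∑ ij ∈ Finset.HasAntidiagonal.antidiagonal n,
          (n.choose ij.1 : A) * (w ij.1 * bellCoeff D u (ij.2 + 1) (k + 1)) =
          ∑ ij ∈ Finset.HasAntidiagonal.antidiagonal n,
            (n.choose ij.1 : A) * (w ij.1 * D (bellCoeff D u ij.2 (k + 1))) +
          u * ∑ ij ∈ Finset.HasAntidiagonal.antidiagonal n,
            (n.choose ij.1 : A) * (w ij.1 * bellCoeff D u ij.2 k) := by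
        rw [Finset.mul_sum, ← Finset.sum_add_distrib]
        refine Finset.sum_congr rfl fun ij _ => ?_
        rw [bellCoeff]
        ring
      rw [hmid, ← ihk, bellCoeff]
      push_cast at hD ⊢
      linear_combination hD

/-- **Hochschild's formula**: in characteristic `p`, if `u = D x / x` then
`Dᵖ x / x = Dᵖ⁻¹ u + uᵖ`. -/
lemma Derivation.iterate_char_eq [IsDomain A] {p : ℕ} (hp : p.Prime) [CharP A p] {x : A}
    (hx : D x = x * u) : D^[p] x = x * (D^[p - 1] u + u ^ p) := by
  have hvanish (k : ℕ) (hk : k ≠ 0) (hkp : k + 1 < p) : bellCoeff D u p (k + 1) = 0 := by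
    have hne : (k : A) + 1 ≠ 0 := by
      have := mt (CharP.cast_eq_zero_iff A p (k + 1)).1 (Nat.not_dvd_of_pos_of_lt k.succ_pos hkp)
      exact_mod_cast this
    refine (mul_eq_zero.1 ?_).resolve_left hne
    rw [succ_mul_bellCoeff]
    refine Finset.sum_eq_zero ?_
    rintro ⟨i, j⟩ hij
    rw [Finset.HasAntidiagonal.mem_antidiagonal] at hij
    dsimp only at hij ⊢
    by_cases hi : i = 0
    · simp [hi]
    by_cases hj : j = 0
    · rw [hj, bellCoeff_eq_zero_of_lt D u (Nat.pos_of_ne_zero hk), mul_zero, mul_zero]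
    rw [(CharP.cast_eq_zero_iff A p _).2 (hp.dvd_choose_self hi (by omega)), zero_mul]
  obtain ⟨q, rfl⟩ : ∃ q, p = q + 2 := ⟨p - 2, by have := hp.two_le; omega⟩
  rw [iterate_eq_mul_sum_bellCoeff D u hx, Finset.sum_range_succ, bellCoeff_self,
    Finset.sum_eq_single_of_mem 1 (by simp), bellCoeff_succ_one]
  · rfl
  · intro k hk hk1
    cases k with
    | zero => exact bellCoeff_succ_zero D u _
    | succ k => exact hvanish k (by omega) (by simpa using hk)

end HochschildFormula

namespace Derivation

section IterateChar

variable {R A : Type*} [CommRing R] [CommRing A] [Algebra R A] (D : Derivation R A A)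

lemma iterate_mul (n : ℕ) (a b : A) :
    D^[n] (a * b) = ∑ ij ∈ Finset.HasAntidiagonal.antidiagonal n,
      (n.choose ij.1 : A) * (D^[ij.1] a * D^[ij.2] b) := by
  induction n with
  | zero => simp
  | succ n ih =>
    rw [Finset.sum_antidiagonal_choose_succ_mul (fun i j => D^[i] a * D^[j] b),
      ← Finset.sum_add_distrib, Function.iterate_succ_apply', ih, map_sum]
    refine Finset.sum_congr rfl fun ij hij => ?_
    rw [Nat.choose_symm_of_eq_add (Finset.HasAntidiagonal.mem_antidiagonal.1 hij).symm]
    simp only [D.leibniz, D.map_natCast, smul_eq_mul, Function.iterate_succ_apply']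
    ring

/-- In characteristic `p`, the `p`-th iterate of a derivation is a derivation. -/
def iterateChar {p : ℕ} (hp : p.Prime) [CharP A p] : Derivation R A A :=
  Derivation.mk' ((D : A →ₗ[R] A) ^ p) fun a b => by
    simp only [Module.End.pow_apply, coeFn_coe, smul_eq_mul]
    rw [iterate_mul, ← Finset.sum_subset (s₁ := {(0, p), (p, 0)})]
    · rw [Finset.sum_pair (by simp [hp.ne_zero.symm])]
      simp
      ring
    · intro ij
      simp only [Finset.mem_insert, Finset.mem_singleton, Finset.HasAntidiagonal.mem_antidiagonal]
      rintro (rfl | rfl) <;> simp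
    · rintro ⟨i, j⟩ hij hne
      rw [Finset.HasAntidiagonal.mem_antidiagonal] at hij
      simp only [Finset.mem_insert, Finset.mem_singleton, Prod.mk.injEq, not_or] at hne
      rw [(CharP.cast_eq_zero_iff A p _).2 (hp.dvd_choose_self (by omega) (by omega)), zero_mul]

lemma iterateChar_apply {p : ℕ} (hp : p.Prime) [CharP A p] (a : A) :
    D.iterateChar hp a = D^[p] a := by
  simp [iterateChar, Module.End.pow_apply]

lemma iterate_const_mul {c : A} (hc : D c = 0) (n : ℕ) (a : A) : D^[n] (c * a) = c * D^[n] a := by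
  induction n with
  | zero => rfl
  | succ n ih => simp [Function.iterate_succ_apply', ih, hc]

end IterateChar

section Monomial

variable {k K : Type*} [Field k] [Field K] [Algebra k K] (D : Derivation k K K)

lemma map_zpow_eq (z : K) (n : ℤ) : D (z ^ n) = (n : K) * (z ^ (n - 1) * D z) := by
  rw [D.leibniz_zpow, zsmul_eq_mul, smul_eq_mul]

variable {p : ℕ} [CharP K p] {x y : K} {mx my : ℤ}

lemma map_zpow_eq_zero {n : ℤ} (h : (p : ℤ) ∣ n) (z : K) : D (z ^ n) = 0 := by
  rw [map_zpow_eq, (CharP.intCast_eq_zero_iff K p n).2 h, zero_mul]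

lemma not_pClosed_of_dvd_of_not_dvd (hp : p.Prime) (hx : x ≠ 0) (hy : y ≠ 0)
    (hDx : D x = y ^ my) (hDy : D y = x ^ mx) (hnx : (p : ℤ) ∣ mx + 1)
    (hny : ¬(p : ℤ) ∣ my + 1) : ¬∃ a, ∀ z, D^[p] z = a * D z := by
  rintro ⟨a, ha⟩
  have hnx' := map_zpow_eq_zero D hnx x
  have hn : ((my + 1 : ℤ) : K) ≠ 0 := mt (CharP.intCast_eq_zero_iff K p _).1 hny
  have hf : D (y ^ (my + 1)) = ((my + 1 : ℤ) : K) * x ^ (mx + 1) * (D x / x) := by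
    rw [map_zpow_eq, hDy, hDx, add_sub_cancel_right, zpow_add_one₀ hx]
    field_simp
  have hc : D (((my + 1 : ℤ) : K) * x ^ (mx + 1)) = 0 := by
    simp [D.leibniz, hnx', -Int.cast_add]
  have hform := iterate_char_eq D (D x / x) hp (x := x) (by field_simp)
  have hpf := ha (y ^ (my + 1))
  obtain ⟨q, rfl⟩ : ∃ q, p = q + 1 := ⟨p - 1, by have := hp.pos; omega⟩
  rw [Function.iterate_succ_apply, hf, iterate_const_mul D hc] at hpf
  have hc0 : ((my + 1 : ℤ) : K) * x ^ (mx + 1) ≠ 0 := mul_ne_zero hn (zpow_ne_zero _ hx)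
  have hq : D^[q] (D x / x) = a * (D x / x) := by
    apply mul_left_cancel₀ hc0
    linear_combination hpf
  rw [ha, Nat.add_sub_cancel, hq] at hform
  have hpow : x * (D x / x) ^ (q + 1) = 0 := by
    linear_combination -hform - a * div_mul_cancel₀ (D x) hx
  refine mul_ne_zero hx (pow_ne_zero _ (div_ne_zero ?_ hx)) hpow
  rw [hDx]
  exact zpow_ne_zero _ hy

lemma zpow_eq_zpow_of_pClosed_of_dvd (hp : p.Prime) (hx : x ≠ 0) (hy : y ≠ 0)
    (hDx : D x = y ^ my) (hDy : D y = x ^ mx) (hnx : (p : ℤ) ∣ mx + 1)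
    (hny : (p : ℤ) ∣ my + 1) (h : ∃ a, ∀ z, D^[p] z = a * D z) :
    (x ^ (mx + 1)) ^ (p - 1) = (y ^ (my + 1)) ^ (p - 1) := by
  obtain ⟨a, ha⟩ := h
  have hcx := map_zpow_eq_zero D hnx x
  have hcy := map_zpow_eq_zero D hny y
  have hfx := iterate_char_eq D (D x / x) hp (x := x) (by field_simp)
  have hfy := iterate_char_eq D (D y / y) hp (x := y) (by field_simp)
  have huv : x ^ (mx + 1) * (D x / x) = y ^ (my + 1) * (D y / y) := by
    rw [hDx, hDy, zpow_add_one₀ hx, zpow_add_one₀ hy]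
    field_simp
  have hu0 : D x / x ≠ 0 := div_ne_zero (hDx ▸ zpow_ne_zero _ hy) hx
  have hiter : x ^ (mx + 1) * D^[p - 1] (D x / x) = y ^ (my + 1) * D^[p - 1] (D y / y) := by
    rw [← iterate_const_mul D hcx, ← iterate_const_mul D hcy, huv]
  rw [ha] at hfx hfy
  replace hfx : a * (D x / x) = D^[p - 1] (D x / x) + (D x / x) ^ p := by
    rw [mul_div_assoc', hfx]; field_simp
  replace hfy : a * (D y / y) = D^[p - 1] (D y / y) + (D y / y) ^ p := by
    rw [mul_div_assoc', hfy]; field_simp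
  have hpow : x ^ (mx + 1) * (D x / x) ^ p = y ^ (my + 1) * (D y / y) ^ p := by
    linear_combination a * huv - hiter - x ^ (mx + 1) * hfx + y ^ (my + 1) * hfy
  have huvp := congrArg (· ^ p) huv
  obtain ⟨q, rfl⟩ : ∃ q, p = q + 1 := ⟨p - 1, by have := hp.pos; omega⟩
  simp only [mul_pow, Nat.add_sub_cancel] at huvp ⊢
  generalize x ^ (mx + 1) = c at *
  have hd0 : y ^ (my + 1) ≠ 0 := zpow_ne_zero _ hy
  generalize y ^ (my + 1) = d at *
  have hc0 : c ≠ 0 := by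
    rintro rfl
    have hv0 : D y / y ≠ 0 := div_ne_zero (hDy ▸ zpow_ne_zero _ hx) hy
    simp [hd0, hv0] at huv
  apply mul_right_cancel₀ (mul_ne_zero hc0 (pow_ne_zero (q + 1) hu0))
  linear_combination huvp - d ^ q * hpow

end Monomial

end Derivation

section RationalFunctions

variable {k : Type} [Field k]

lemma xK_ne_zero : xK k ≠ 0 := by simp [xK]

lemma yK_ne_zero : yK k ≠ 0 := by simp [yK]

lemma RatFld2.derivation_eq_zero {E : Derivation k (RatFld2 k) (RatFld2 k)}
    (hx : E (xK k) = 0) (hy : E (yK k) = 0) (z : RatFld2 k) : E z = 0 := by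
  have hpoly (f : MvPolynomial (Fin 2) k) : E (algebraMap _ _ f) = 0 := by
    have h : E.compAlgebraMap (MvPolynomial (Fin 2) k) = 0 :=
      MvPolynomial.derivation_ext fun i => by fin_cases i <;> simpa
    exact Derivation.congr_fun h f
  obtain ⟨f, g, -, rfl⟩ := IsFractionRing.div_surjective (A := MvPolynomial (Fin 2) k) z
  simp [Derivation.leibniz_div, hpoly]

lemma xK_zpow_eq_yK_zpow_iff {a b : ℤ} : xK k ^ a = yK k ^ b ↔ a = 0 ∧ b = 0 := by
  refine ⟨fun h => ?_, fun h => by simp [h.1, h.2]⟩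
  have hmon : xK k ^ a.toNat * yK k ^ (-b).toNat = xK k ^ (-a).toNat * yK k ^ b.toNat := by
    have hx := xK_ne_zero (k := k)
    have hy := yK_ne_zero (k := k)
    have ha : xK k ^ a.toNat = xK k ^ (-a).toNat * xK k ^ a := by
      rw [← zpow_natCast, ← zpow_natCast, ← zpow_add₀ hx]
      congr 1
      omega
    have hb : yK k ^ b.toNat = yK k ^ (-b).toNat * yK k ^ b := by
      rw [← zpow_natCast, ← zpow_natCast, ← zpow_add₀ hy]
      congr 1
      omega
    rw [ha, hb, h]
    ring
  simp only [xK, yK, ← map_pow, ← map_mul] at hmon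
  replace hmon := IsFractionRing.injective (MvPolynomial (Fin 2) k) (RatFld2 k) hmon
  simp only [X_pow_eq_monomial, monomial_mul, one_mul] at hmon
  have hexp := monomial_left_injective (one_ne_zero' k) hmon
  have h0 := DFunLike.congr_fun hexp 0
  have h1 := DFunLike.congr_fun hexp 1
  simp at h0 h1
  omega

end RationalFunctions

/-- Corollary 4 of the paper: for `m_x, m_y ∈ ℤ` and `∂ = y^{m_y}·∂_x + x^{m_x}·∂_y` on
`K = k(x,y)` (negative exponents denoting inverses), with `n_x = m_x + 1` and
`n_y = m_y + 1`, the derivation `∂` is `p`-closed iff either `p ∤ n_x` and `p ∤ n_y`, or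
`n_x = n_y = 0`. -/
theorem monomial_derivation_p_closed_iff_int
    (p : ℕ) (hp : p.Prime) (k : Type) [Field k] [CharP k p]
    (Dx Dy : Derivation k (RatFld2 k) (RatFld2 k))
    (hDxx : Dx (xK k) = 1) (hDxy : Dx (yK k) = 0)
    (hDyx : Dy (xK k) = 0) (hDyy : Dy (yK k) = 1)
    (mx my : ℤ) :
    (∃ a : RatFld2 k, ∀ z,
        (⇑((yK k ^ my) • Dx + (xK k ^ mx) • Dy))^[p] z
          = a * ((yK k ^ my) • Dx + (xK k ^ mx) • Dy) z)
      ↔ ((¬(p : ℤ) ∣ (mx + 1) ∧ ¬(p : ℤ) ∣ (my + 1)) ∨ (mx + 1 = 0 ∧ my + 1 = 0)) := by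
  have : CharP (RatFld2 k) p :=
    charP_of_injective_algebraMap (algebraMap k (RatFld2 k)).injective p
  have hx := xK_ne_zero (k := k)
  have hy := yK_ne_zero (k := k)
  set D := (yK k ^ my) • Dx + (xK k ^ mx) • Dy with hD
  have hDx : D (xK k) = yK k ^ my := by simp [hD, hDxx, hDyx]
  have hDy : D (yK k) = xK k ^ mx := by simp [hD, hDxy, hDyy]
  constructor
  · intro h
    by_cases hnx : (p : ℤ) ∣ mx + 1 <;> by_cases hny : (p : ℤ) ∣ my + 1
    · right
      have hpow := D.zpow_eq_zpow_of_pClosed_of_dvd hp hx hy hDx hDy hnx hny h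
      rw [← zpow_natCast, ← zpow_natCast, ← zpow_mul, ← zpow_mul, xK_zpow_eq_yK_zpow_iff] at hpow
      have hp1 : ((p - 1 : ℕ) : ℤ) ≠ 0 := by have := hp.two_le; omega
      simpa only [mul_eq_zero, hp1, or_false] using hpow
    · exact absurd h (D.not_pClosed_of_dvd_of_not_dvd hp hx hy hDx hDy hnx hny)
    · exact absurd h (D.not_pClosed_of_dvd_of_not_dvd hp hy hx hDy hDx hny hnx)
    · exact .inl ⟨hnx, hny⟩
  · intro h
    refine ⟨D^[p] (xK k) / D (xK k), fun z => ?_⟩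
    set E : Derivation k (RatFld2 k) (RatFld2 k) :=
      D.iterateChar hp - (D^[p] (xK k) / D (xK k)) • D with hE
    have hE_apply (z : RatFld2 k) : E z = D^[p] z - D^[p] (xK k) / D (xK k) * D z := by
      simp [hE, Derivation.iterateChar_apply]
    have hEx : E (xK k) = 0 := by
      rw [hE_apply, div_mul_cancel₀ _ (hDx ▸ zpow_ne_zero _ hy), sub_self]
    have hE_const {f : RatFld2 k} (hf : D f = 0) : E f = 0 := by
      obtain ⟨q, rfl⟩ : ∃ q, p = q + 1 := ⟨p - 1, by have := hp.pos; omega⟩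
      rw [hE_apply, Function.iterate_succ_apply, hf, iterate_map_zero, mul_zero, sub_zero]
    suffices hEy : E (yK k) = 0 by
      rw [← sub_eq_zero, ← hE_apply]
      exact RatFld2.derivation_eq_zero hEx hEy z
    rcases h with ⟨hnx, hny⟩ | ⟨hnx, hny⟩
    · have hnx' : ((mx + 1 : ℤ) : RatFld2 k) ≠ 0 := mt (CharP.intCast_eq_zero_iff _ p _).1 hnx
      have hny' : ((my + 1 : ℤ) : RatFld2 k) ≠ 0 := mt (CharP.intCast_eq_zero_iff _ p _).1 hny
      have hf := @hE_const (((my + 1 : ℤ) : RatFld2 k) * xK k ^ (mx + 1) -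
        ((mx + 1 : ℤ) : RatFld2 k) * yK k ^ (my + 1)) (by
          simp only [map_sub, Derivation.leibniz, Derivation.map_intCast, smul_eq_mul, mul_zero,
            add_zero, Derivation.map_zpow_eq, hDx, hDy, add_sub_cancel_right]
          ring)
      simp only [map_sub, Derivation.leibniz, Derivation.map_intCast, smul_eq_mul, mul_zero,
        add_zero, Derivation.map_zpow_eq, hEx, add_sub_cancel_right, zero_sub, neg_eq_zero,
        mul_eq_zero, hnx', hny', zpow_ne_zero my hy, false_or] at hf
      exact hf
    · obtain rfl : mx = -1 := by omega
      obtain rfl : my = -1 := by omega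
      have hf := @hE_const (xK k / yK k) (by
        simp [Derivation.leibniz_div, hDx, hDy, hx, hy])
      simpa [Derivation.leibniz_div, hEx, hx, hy] using hf
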